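/- Under the hypotheses (i)–(v) on w and submodularity of F(S) = w({1,...,|S|}, S), the following holds. Let I ⊆ [n] be an interval and S ⊆ [n] with |I| = |S|, and let t ∈ [n] with t > max(I) be such that (I∪{t})∖{max(I)} ⪯ S. Then w(I,S) ≥ w((I∪{t})∖{max(I)}, S). -/

import Mathlib

open Finset

/-- The maximum of the three quantities is attained by at least two of them. -/
def MaxTwiceW (x y z : WithBot ℝ) : Prop :=
  (x = y ∧ z ≤ x) ∨ (x = z ∧ y ≤ x) ∨ (y = z ∧ x ≤ y)

/-- `T ⪯ S`: the sets have the same size and, for each `j`, the `j`-th smallest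
element of `T` is at most the `j`-th smallest element of `S`. -/
def PrecEq (T S : Finset ℕ) : Prop :=
  ∃ h : T.card = S.card, ∀ j : Fin S.card,
    T.orderEmbOfFin h j ≤ S.orderEmbOfFin rfl j

/-- A nonempty set of consecutive integers. -/
def IsIntervalN (I : Finset ℕ) : Prop :=
  I.Nonempty ∧ ∀ a ∈ I, ∀ b ∈ I, ∀ c : ℕ, a ≤ c → c ≤ b → c ∈ I

/-- Hypotheses (i)-(v) on `w`, together with submodularity of
`F(S) = w({1,...,|S|}, S)`, on the ground set `{1, ..., n}`. -/
structure WHyp (n : ℕ) (w : Finset ℕ → Finset ℕ → WithBot ℝ) : Prop where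
  /-- (i) top-justified values are finite -/
  h1 : ∀ S ⊆ Icc 1 n, w (Icc 1 S.card) S ≠ ⊥
  /-- (ii) `w(T,S) = -∞` when `T ⪯ S` fails -/
  h2 : ∀ T ⊆ Icc 1 n, ∀ S ⊆ Icc 1 n, T.card = S.card → ¬ PrecEq T S → w T S = ⊥
  /-- (iii) splitting off an initial interval -/
  h3 : ∀ I ⊆ Icc 1 n, IsIntervalN I → ∀ T ⊆ Icc 1 n, ∀ S ⊆ Icc 1 n,
      T.card = S.card → (∀ i ∈ I, ∀ x ∈ T ∪ S, i < x) →
      w (I ∪ T) (I ∪ S) = (∑ i ∈ I, w {i} {i}) + w T S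
  /-- (iv) splitting off a final element -/
  h4 : ∀ T ⊆ Icc 1 n, ∀ S ⊆ Icc 1 n, T.card = S.card →
      ∀ t ∈ Icc 1 n, ∀ s ∈ Icc 1 n, t ∉ T → s ∉ S →
      (∀ x ∈ T ∪ S, x ≤ t) → (∀ x ∈ T ∪ S, x ≤ s) →
      w (insert t T) (insert s S) = w T S + w {t} {s}
  /-- (v) three-term tropical Plücker relations in the rows -/
  h5 : ∀ S ⊆ Icc 1 n, 2 ≤ S.card → ∀ R ⊆ Icc 1 n, R.card = S.card - 2 →
      ∀ a ∈ Icc 1 n, ∀ b ∈ Icc 1 n, ∀ c ∈ Icc 1 n, ∀ d ∈ Icc 1 n,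
      a < b → b < c → c < d → a ∉ R → b ∉ R → c ∉ R → d ∉ R →
      MaxTwiceW (w (R ∪ {a, b}) S + w (R ∪ {c, d}) S)
                (w (R ∪ {a, c}) S + w (R ∪ {b, d}) S)
                (w (R ∪ {a, d}) S + w (R ∪ {b, c}) S)
  /-- submodularity of `F(S) = w({1,...,|S|}, S)` -/
  hsub : ∀ S ⊆ Icc 1 n, ∀ T ⊆ Icc 1 n,
      w (Icc 1 (S ∩ T).card) (S ∩ T) + w (Icc 1 (S ∪ T).card) (S ∪ T) ≤
        w (Icc 1 S.card) S + w (Icc 1 T.card) T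


lemma prec_lower {T S : Finset ℕ} (h : PrecEq T S) : ∀ s ∈ S, ∃ t ∈ T, t ≤ s := by
  obtain ⟨hc, hj⟩ := h
  intro s hs
  have : s ∈ Set.range (S.orderEmbOfFin rfl) := by
    rw [Finset.range_orderEmbOfFin]; exact hs
  obtain ⟨j, rfl⟩ := this
  exact ⟨_, Finset.orderEmbOfFin_mem T hc j, hj j⟩

lemma prec_upper {T S : Finset ℕ} (h : PrecEq T S) : ∀ t ∈ T, ∃ s ∈ S, t ≤ s := by
  obtain ⟨hc, hj⟩ := h
  intro s hs
  have : s ∈ Set.range (T.orderEmbOfFin hc) := by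
    rw [Finset.range_orderEmbOfFin]; exact hs
  obtain ⟨j, rfl⟩ := this
  exact ⟨_, Finset.orderEmbOfFin_mem S rfl j, hj j⟩

lemma isInt_Icc {p q : ℕ} (h : p ≤ q) : IsIntervalN (Icc p q) := by
  refine ⟨⟨p, by simp [h]⟩, ?_⟩
  intro a ha b hb c h1 h2
  simp only [mem_Icc] at *
  omega

lemma diag_ne {n : ℕ} {w : Finset ℕ → Finset ℕ → WithBot ℝ} (hw : WHyp n w) (i : ℕ)
    (hi : i ∈ Icc 1 n) : w {i} {i} ≠ ⊥ := by
  simp only [mem_Icc] at hi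
  have h := hw.h1 (Icc 1 i) (Icc_subset_Icc le_rfl hi.2)
  have e := hw.h4 (Icc 1 (i-1)) (Icc_subset_Icc le_rfl (by omega)) (Icc 1 (i-1))
    (Icc_subset_Icc le_rfl (by omega)) rfl i (by simp; omega) i (by simp; omega)
    (by simp; omega) (by simp; omega) (by simp; omega) (by simp; omega)
  have hI : insert i (Icc 1 (i-1)) = Icc 1 i := by ext x; simp; omega
  rw [hI] at e
  simp only [Nat.card_Icc, Nat.add_sub_cancel] at h
  rw [e] at h
  intro h0
  rw [h0] at h
  simp at h

lemma pre_ne {n : ℕ} {w : Finset ℕ → Finset ℕ → WithBot ℝ} (hw : WHyp n w) (p : ℕ)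
    (hp : p ≤ n) : ∑ i ∈ Icc 1 p, w {i} {i} ≠ ⊥ := by
  rw [Ne, WithBot.sum_eq_bot_iff]
  rintro ⟨i, hi, h⟩
  exact diag_ne hw i (by simp at *; omega) h

/-- splitting off an initial segment -/
lemma split {n : ℕ} {w : Finset ℕ → Finset ℕ → WithBot ℝ} (hw : WHyp n w) (p : ℕ)
    (hp : p ≤ n) (T S : Finset ℕ) (hT : T ⊆ Icc 1 n) (hS : S ⊆ Icc 1 n)
    (hc : T.card = S.card) (hT' : ∀ x ∈ T, p < x) (hS' : ∀ x ∈ S, p < x) :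
    w (Icc 1 p ∪ T) (Icc 1 p ∪ S) = (∑ i ∈ Icc 1 p, w {i} {i}) + w T S := by
  rcases Nat.eq_zero_or_pos p with rfl | h
  · simp
  · apply hw.h3 _ (Icc_subset_Icc le_rfl hp) (isInt_Icc h) T hT S hS hc
    intro i hi x hx
    simp only [mem_Icc, mem_union] at *
    rcases hx with hx | hx
    · have := hT' x hx; omega
    · have := hS' x hx; omega

lemma addElt {n : ℕ} {w : Finset ℕ → Finset ℕ → WithBot ℝ} (hw : WHyp n w) (p : ℕ)
    (hp : p + 1 ≤ n) (T S : Finset ℕ) (hT : T ⊆ Icc 1 n) (hS : S ⊆ Icc 1 n)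
    (hc : T.card = S.card) (hT' : Icc 1 p ⊆ T) (hS' : Icc 1 p ⊆ S)
    (hT'' : p + 1 ∉ T) (hS'' : p + 1 ∉ S) :
    w (insert (p+1) T) (insert (p+1) S) = w {p+1} {p+1} + w T S := by
  have hcc : (T \ Icc 1 p).card = (S \ Icc 1 p).card := by
    rw [card_sdiff_of_subset hT', card_sdiff_of_subset hS', hc]
  have key : ∀ U ⊆ Icc 1 n, p + 1 ∉ U → ∀ x ∈ U \ Icc 1 p, p + 1 < x := by
    intro U hU hpU x hx
    have h1 := hU (mem_sdiff.1 hx).1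
    have h2 := (mem_sdiff.1 hx).2
    have h3 : x ≠ p + 1 := fun h => hpU (h ▸ (mem_sdiff.1 hx).1)
    simp only [mem_Icc] at *
    omega
  have e1 : ∀ U, Icc 1 p ⊆ U → Icc 1 p ∪ (U \ Icc 1 p) = U := fun U h =>
    union_sdiff_of_subset h
  have e2 : ∀ U, Icc 1 p ⊆ U → Icc 1 (p+1) ∪ (U \ Icc 1 p) = insert (p+1) U := by
    intro U h
    have : Icc 1 (p+1) = insert (p+1) (Icc 1 p) := by ext x; simp; omega
    rw [this, insert_union, e1 U h]
  have s1 := split hw p (by omega) (T \ Icc 1 p) (S \ Icc 1 p) (sdiff_subset.trans hT)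
    (sdiff_subset.trans hS) hcc (fun x hx => by have := key T hT hT'' x hx; omega)
    (fun x hx => by have := key S hS hS'' x hx; omega)
  have s2 := split hw (p+1) (by omega) (T \ Icc 1 p) (S \ Icc 1 p) (sdiff_subset.trans hT)
    (sdiff_subset.trans hS) hcc (key T hT hT'') (key S hS hS'')
  rw [e1 T hT', e1 S hS'] at s1
  rw [e2 T hT', e2 S hS'] at s2
  rw [s1, s2, Finset.sum_Icc_succ_top (by omega)]
  rw [← add_assoc, add_comm (w {p+1} {p+1})]

lemma arith (α β γ δ ε ζ u c P Q : WithBot ℝ) (hα : α ≠ ⊥) (hu : u ≠ ⊥) (hc : c ≠ ⊥)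
    (hP : P ≠ ⊥) (hε : ε ≠ ⊥) (hQ : Q ≠ ⊥)
    (hm : MaxTwiceW (α + (β + u)) (γ + (δ + u)) ((ε + u) + ζ))
    (h1 : c + β ≤ P) (h2 : P = c + δ) (h3 : c + ζ ≤ Q) (h4 : ε + Q ≤ α + P) : γ ≤ α := by
  lift α to ℝ using hα
  lift u to ℝ using hu
  lift c to ℝ using hc
  lift P to ℝ using hP
  lift Q to ℝ using hQ
  lift ε to ℝ using hε
  unfold MaxTwiceW at hm
  induction δ with
  | bot => simp at h2
  | coe δ =>
  induction γ with
  | bot => simp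
  | coe γ =>
  by_contra hlt
  induction β with
  | bot =>
    induction ζ with
    | bot =>
      simp only [← WithBot.coe_add, WithBot.bot_add, WithBot.add_bot] at *
      simp at hm
      rw [← WithBot.coe_add, ← WithBot.coe_add] at hm
      exact WithBot.bot_ne_coe hm
    | coe ζ =>
      simp only [← WithBot.coe_add, WithBot.bot_add, WithBot.add_bot, WithBot.coe_le_coe, WithBot.coe_inj] at *
      simp at hm
      linarith [hm]
  | coe β =>
    induction ζ with
    | bot =>
      simp only [← WithBot.coe_add, WithBot.bot_add, WithBot.add_bot, WithBot.coe_le_coe, WithBot.coe_inj] at *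
      simp at hm
      linarith [hm]
    | coe ζ =>
      simp only [← WithBot.coe_add, WithBot.coe_le_coe, WithBot.coe_inj] at *
      rcases hm with hm | hm | hm <;> linarith [hm.1, hm.2]

lemma arith2 (a b c d e : WithBot ℝ) (hc : c ≠ ⊥) (h : a + d ≤ b + c) (h2 : d = c + e) :
    a + e ≤ b := by
  subst h2
  rw [add_left_comm, add_comm b c] at h
  exact (WithBot.add_le_add_iff_left hc).1 h

lemma mainB {n : ℕ} {w : Finset ℕ → Finset ℕ → WithBot ℝ} (hw : WHyp n w) :
    ∀ m p : ℕ, p + m = n + 1 → ∀ S ⊆ Icc 1 n, Icc 1 p ⊆ S → ∀ t, S.card ≤ t →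
      (∃ s ∈ S, t ≤ s) → w (insert t (Icc 1 (S.card - 1))) S ≤ w (Icc 1 S.card) S := by
  intro m
  induction m with
  | zero =>
    intro p hp S hS hpS
    have := hS (hpS (show p ∈ Icc 1 p by simp; omega))
    simp at this; omega
  | succ m ih =>
    intro p hp S hS hpS t ht hs
    by_cases hpn : p + 1 ∈ S
    · refine ih (p+1) (by omega) S hS ?_ t ht hs
      intro x hx
      by_cases hx' : x = p + 1
      · rwa [hx']
      · apply hpS; simp at *; omega
    have hne : S.Nonempty := ⟨_, hs.choose_spec.1⟩
    obtain ⟨d, hd, hdmax⟩ : ∃ d ∈ S, ∀ x ∈ S, x ≤ d :=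
      ⟨S.max' hne, S.max'_mem hne, fun x hx => S.le_max' x hx⟩
    have htd : t ≤ d := by obtain ⟨s, h, h'⟩ := hs; exact h'.trans (hdmax s h)
    have hdn := hS hd
    have hk : 0 < S.card := card_pos.2 hne
    obtain ⟨k, hkS⟩ : ∃ k, S.card = k + 1 := ⟨S.card - 1, by omega⟩
    rw [hkS] at ht ⊢
    simp only [Nat.add_sub_cancel]
    simp only [mem_Icc] at hdn
    set S' := S.erase d with hS'def
    have hS'S : S' ⊆ S := erase_subset _ _
    have hS' : S' ⊆ Icc 1 n := hS'S.trans hS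
    have hcS' : S'.card = k := by rw [hS'def, card_erase_of_mem hd, hkS]; simp
    have hdS' : d ∉ S' := by simp [hS'def]
    have hins : insert d S' = S := insert_erase hd
    have hlt : ∀ x ∈ S', x < d := by
      intro x hx
      have := hdmax x (hS'S hx)
      have h2 : x ≠ d := fun h => hdS' (h ▸ hx)
      omega
    rcases Nat.eq_or_lt_of_le ht with rfl | htk
    · have : insert (k+1) (Icc 1 k) = Icc 1 (k+1) := by ext x; simp; omega
      rw [this]
    by_cases hbase : ∀ x ∈ S', x < t
    · -- base case
      have e1 := hw.h4 (Icc 1 k) (Icc_subset_Icc le_rfl (by omega)) S' hS' (by simp [hcS'])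
        t (by simp; omega) d (by simp; omega) (by simp; omega) hdS'
        (by
          intro x hx
          rcases mem_union.1 hx with h | h
          · simp at h; omega
          · exact (hbase x h).le)
        (by
          intro x hx
          rcases mem_union.1 hx with h | h
          · simp at h; omega
          · exact (hlt x h).le)
      have e2 := hw.h4 (Icc 1 (t-1)) (Icc_subset_Icc le_rfl (by omega)) (Icc 1 (t-1))
        (Icc_subset_Icc le_rfl (by omega)) rfl
        t (by simp; omega) d (by simp; omega) (by simp; omega) (by simp; omega)
        (by intro x hx; simp at hx; omega) (by intro x hx; simp at hx; omega)
      have hI : insert t (Icc 1 (t-1)) = Icc 1 t := by ext x; simp; omega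
      rw [hins] at e1
      rw [hI] at e2
      rw [e1]
      have hsub := hw.hsub S hS (Icc 1 (t-1)) (Icc_subset_Icc le_rfl (by omega))
      have i1 : S ∩ Icc 1 (t-1) = S' := by
        ext x
        simp only [mem_inter, mem_Icc]
        constructor
        · rintro ⟨hx, h1, h2⟩
          exact mem_erase.2 ⟨by omega, hx⟩
        · intro hx
          have h1 := hbase x hx
          have h2 := hS' hx
          simp at h2
          exact ⟨hS'S hx, by omega, by omega⟩
      have i2 : S ∪ Icc 1 (t-1) = insert d (Icc 1 (t-1)) := by
        ext x
        simp only [mem_union, mem_Icc, mem_insert]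
        constructor
        · rintro (hx | hx)
          · by_cases hxd : x = d
            · exact Or.inl hxd
            · have h1 := hbase x (mem_erase.2 ⟨hxd, hx⟩)
              have h2 := hS hx
              simp at h2
              right; omega
          · exact Or.inr hx
        · rintro (rfl | hx)
          · exact Or.inl hd
          · exact Or.inr hx
      have hc2 : (insert d (Icc 1 (t-1))).card = t := by
        rw [card_insert_of_notMem (by simp; omega)]; simp; omega
      rw [i1, i2, hc2, hcS', hkS] at hsub
      have hf := hw.h1 (Icc 1 (t-1)) (Icc_subset_Icc le_rfl (by omega))
      simp only [Nat.card_Icc, Nat.add_sub_cancel] at hsub hf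
      exact arith2 _ _ _ _ _ hf hsub e2
    · -- main case
      push Not at hbase
      obtain ⟨x, hxS', hxt⟩ := hbase
      have hxd := hlt x hxS'
      have hpk : p + 1 ≤ k := by
        have hx2 : x ∉ Icc 1 p := by
          intro hx
          simp at hx
          have : (Icc 1 p).card ≤ S.card := card_le_card hpS
          simp at this; omega
        have hd2 : d ∉ insert x (Icc 1 p) := by
          have : (Icc 1 p).card ≤ S.card := card_le_card hpS
          simp at this ⊢; omega
        have hsub : insert d (insert x (Icc 1 p)) ⊆ S := by
          intro y hy
          simp only [mem_insert] at hy
          rcases hy with rfl | rfl | hy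
          · exact hd
          · exact hS'S hxS'
          · exact hpS hy
        have := card_le_card hsub
        rw [card_insert_of_notMem hd2, card_insert_of_notMem hx2, hkS] at this
        simp at this; omega
      have hpS' : Icc 1 p ⊆ S' := by
        intro y hy
        refine mem_erase.2 ⟨?_, hpS hy⟩
        simp at hy; omega
      have hpnS' : p + 1 ∉ S' := fun h => hpn (hS'S h)
      set R := (Icc 1 k).erase (p+1) with hR
      have hRm : ∀ y, y ∈ R ↔ y ≠ p + 1 ∧ 1 ≤ y ∧ y ≤ k := by intro y; simp [hR]
      have hRn : R ⊆ Icc 1 n := by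
        intro y hy; rw [hRm] at hy; simp; omega
      have hRc : R.card = k - 1 := by
        rw [hR, card_erase_of_mem (by simp; omega)]; simp
      have hRp : Icc 1 p ⊆ R := by
        intro y hy; rw [hRm]; simp at hy; omega
      have hRk : k + 1 ∉ R := by rw [hRm]; omega
      have hRt : t ∉ R := by rw [hRm]; omega
      have hRd : d ∉ R := by rw [hRm]; omega
      have hRe : p + 1 ∉ R := by rw [hRm]; omega
      have hP := hw.h5 S hS (by omega) R hRn (by omega) (p+1) (by simp; omega) (k+1)
        (by simp; omega) t (by simp; omega) d (by simp; omega) (by omega) htk (by omega)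
        hRe hRk hRt hRd
      have r1 : R ∪ {p+1, k+1} = Icc 1 (k+1) := by
        ext y; simp only [mem_union, hRm, mem_insert, mem_singleton, mem_Icc]; omega
      have r2 : R ∪ {t, d} = insert d (insert t R) := by
        ext y; simp only [mem_union, mem_insert, mem_singleton]; tauto
      have r3 : R ∪ {p+1, t} = insert t (Icc 1 k) := by
        ext y; simp only [mem_union, hRm, mem_insert, mem_singleton, mem_Icc]; omega
      have r4 : R ∪ {k+1, d} = insert d (insert (k+1) R) := by
        ext y; simp only [mem_union, mem_insert, mem_singleton]; tauto
      have r5 : R ∪ {p+1, d} = insert d (Icc 1 k) := by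
        ext y; simp only [mem_union, hRm, mem_insert, mem_singleton, mem_Icc]; omega
      have r6 : R ∪ {k+1, t} = insert t (insert (k+1) R) := by
        ext y; simp only [mem_union, mem_insert, mem_singleton]; tauto
      rw [r1, r2, r3, r4, r5, r6] at hP
      -- splitting off the top element
      have top : ∀ T ⊆ Icc 1 n, T.card = k → (∀ y ∈ T, y < d) →
          w (insert d T) S = w T S' + w {d} {d} := by
        intro T hT hTc hTd
        have := hw.h4 T hT S' hS' (by omega) d (by simp; omega) d (by simp; omega)
          (fun h => absurd (hTd d h) (lt_irrefl _)) hdS'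
          (by
            intro y hy
            rcases mem_union.1 hy with h | h
            · exact (hTd y h).le
            · exact (hlt y h).le)
          (by
            intro y hy
            rcases mem_union.1 hy with h | h
            · exact (hTd y h).le
            · exact (hlt y h).le)
        rwa [hins] at this
      have insn : ∀ z T, 1 ≤ z → z ≤ n → T ⊆ Icc 1 n → insert z T ⊆ Icc 1 n := by
        intro z T h1 h2 hT
        exact insert_subset (by simp; omega) hT
      have cRt : (insert t R).card = k := by rw [card_insert_of_notMem hRt]; omega
      have cRk : (insert (k+1) R).card = k := by rw [card_insert_of_notMem hRk]; omega
      rw [top (insert t R) (insn _ _ (by omega) (by omega) hRn) cRt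
          (by intro y hy; rw [mem_insert, hRm] at hy; omega),
        top (insert (k+1) R) (insn _ _ (by omega) (by omega) hRn) cRk
          (by intro y hy; rw [mem_insert, hRm] at hy; omega),
        top (Icc 1 k) (Icc_subset_Icc le_rfl (by omega)) (by simp)
          (by intro y hy; simp at hy; omega)] at hP
      have a1 := addElt hw p (by omega) (insert t R) S' (insn _ _ (by omega) (by omega) hRn) hS'
        (by omega) (hRp.trans (subset_insert _ _)) hpS' (by rw [mem_insert, hRm]; omega) hpnS'
      have a2 := addElt hw p (by omega) (insert (k+1) R) S' (insn _ _ (by omega) (by omega) hRn) hS'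
        (by omega) (hRp.trans (subset_insert _ _)) hpS' (by rw [mem_insert, hRm]; omega) hpnS'
      have htk1 : t ∉ insert (k+1) R := by rw [mem_insert, hRm]; omega
      have a3 := addElt hw p (by omega) (insert t (insert (k+1) R)) S
        (insn _ _ (by omega) (by omega) (insn _ _ (by omega) (by omega) hRn)) hS
        (by rw [card_insert_of_notMem htk1]; omega)
        ((hRp.trans (subset_insert _ _)).trans (subset_insert _ _)) hpS
        (by rw [mem_insert, mem_insert, hRm]; omega) hpn
      have q1 : insert (p+1) (insert t R) = insert t (Icc 1 k) := by
        ext y; simp only [hRm, mem_insert, mem_Icc]; omega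
      have q2 : insert (p+1) (insert (k+1) R) = Icc 1 (k+1) := by
        ext y; simp only [hRm, mem_insert, mem_Icc]; omega
      have q3 : insert (p+1) (insert t (insert (k+1) R)) = insert t (Icc 1 (k+1)) := by
        ext y; simp only [hRm, mem_insert, mem_Icc]; omega
      rw [q1] at a1
      rw [q2] at a2
      rw [q3] at a3
      have cA : (insert (p+1) S').card = k + 1 := by rw [card_insert_of_notMem hpnS', hcS']
      have cB : (insert (p+1) S).card = k + 2 := by rw [card_insert_of_notMem hpn, hkS]
      have sA : insert (p+1) S' ⊆ Icc 1 n := insn _ _ (by omega) (by omega) hS'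
      have sB : insert (p+1) S ⊆ Icc 1 n := insn _ _ (by omega) (by omega) hS
      have pre : ∀ U, Icc 1 p ⊆ U → Icc 1 (p+1) ⊆ insert (p+1) U := by
        intro U hU y hy
        by_cases h : y = p + 1
        · simp [h]
        · exact mem_insert_of_mem (hU (by simp at *; omega))
      have b1 := ih (p+1) (by omega) _ sA (pre _ hpS') t (by omega)
        ⟨x, mem_insert_of_mem hxS', hxt⟩
      have b2 := ih (p+1) (by omega) _ sB (pre _ hpS) t (by omega)
        ⟨d, mem_insert_of_mem hd, htd⟩
      have hsub := hw.hsub S hS _ sA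
      have i1 : S ∩ insert (p+1) S' = S' := by
        ext y; simp only [mem_inter, mem_insert]
        constructor
        · rintro ⟨hy, rfl | h⟩
          · exact absurd hy hpn
          · exact h
        · intro h; exact ⟨hS'S h, Or.inr h⟩
      have i2 : S ∪ insert (p+1) S' = insert (p+1) S := by
        ext y; simp only [mem_union, mem_insert]
        constructor
        · rintro (h | h | h)
          · exact Or.inr h
          · exact Or.inl h
          · exact Or.inr (hS'S h)
        · rintro (h | h)
          · exact Or.inr (Or.inl h)
          · exact Or.inl h
      rw [i1, i2, cA, cB, hkS, hcS'] at hsub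
      rw [cA, Nat.add_sub_cancel] at b1
      rw [cB, show k + 2 - 1 = k + 1 by omega] at b2
      have f1 := hw.h1 S hS
      have f2 := hw.h1 S' hS'
      have f3 := hw.h1 _ sA
      have f4 := hw.h1 _ sB
      rw [hkS] at f1
      rw [hcS'] at f2
      rw [cA] at f3
      rw [cB] at f4
      rw [a1] at b1
      rw [a3] at b2
      exact arith _ _ _ _ _ _ _ _ _ _ f1 (diag_ne hw d (by simp; omega))
        (diag_ne hw (p+1) (by simp; omega)) f3 f2 f4 hP b1 a2 b2 hsub

theorem interval_swap_top_inequality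
    (n : ℕ) (w : Finset ℕ → Finset ℕ → WithBot ℝ) (hw : WHyp n w) :
    ∀ I ⊆ Icc 1 n, IsIntervalN I → ∀ S ⊆ Icc 1 n, I.card = S.card →
    ∀ mI ∈ I, (∀ i ∈ I, i ≤ mI) →
    ∀ t ∈ Icc 1 n, mI < t → PrecEq (insert t (I.erase mI)) S →
      w (insert t (I.erase mI)) S ≤ w I S := by
  intro I hI hint S hS hc q hq hqmax t ht hqt hprec
  obtain ⟨p, hpI, hpmin⟩ : ∃ d ∈ I, ∀ x ∈ I, d ≤ x :=
    ⟨I.min' hint.1, I.min'_mem hint.1, fun x hx => I.min'_le x hx⟩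
  have hIeq : I = Icc p q := by
    ext y
    rw [mem_Icc]
    exact ⟨fun h => ⟨hpmin y h, hqmax y h⟩, fun h => hint.2 p hpI q hq y h.1 h.2⟩
  have hp1 := hI hpI
  have hqn := hI hq
  have hpq := hqmax p hpI
  simp only [mem_Icc] at hp1 hqn ht
  have hSp : ∀ s ∈ S, p - 1 < s := by
    intro s hs
    obtain ⟨y, hy, hys⟩ := prec_lower hprec s hs
    rcases mem_insert.1 hy with rfl | h
    · omega
    · have := hpmin y (mem_of_mem_erase h); omega
  obtain ⟨s, hs, hts⟩ := prec_upper hprec t (mem_insert_self _ _)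
  have htI : t ∉ I.erase q := by
    intro h
    have := hqmax t (mem_of_mem_erase h); omega
  have hTc : (insert t (I.erase q)).card = S.card := hprec.choose
  have hTn : insert t (I.erase q) ⊆ Icc 1 n :=
    insert_subset (by simp; omega) ((erase_subset _ _).trans hI)
  have s1 := split hw (p-1) (by omega) I S hI hS hc
    (fun x hx => by have := hpmin x hx; omega) hSp
  have s2 := split hw (p-1) (by omega) _ S hTn hS hTc
    (fun x hx => by
      rcases mem_insert.1 hx with rfl | h
      · omega
      · have := hpmin x (mem_of_mem_erase h); omega) hSp
  have hdisj : Disjoint (Icc 1 (p-1)) S := by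
    rw [disjoint_left]
    intro y hy hyS
    have := hSp y hyS
    simp at hy; omega
  have hcard : (Icc 1 (p-1) ∪ S).card = q := by
    rw [card_union_of_disjoint hdisj, ← hc, hIeq]; simp; omega
  have e1 : Icc 1 (p-1) ∪ I = Icc 1 q := by
    rw [hIeq]; ext y; simp; omega
  have e2 : Icc 1 (p-1) ∪ insert t (I.erase q) = insert t (Icc 1 (q-1)) := by
    rw [hIeq]; ext y; simp; omega
  have hB := mainB hw (n+1) 0 (by omega) (Icc 1 (p-1) ∪ S)
    (union_subset (Icc_subset_Icc le_rfl (by omega)) hS) (by simp) t (by omega)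
    ⟨s, mem_union_right _ hs, hts⟩
  rw [hcard, ← e1, ← e2, s1, s2] at hB
  exact (WithBot.add_le_add_iff_left (pre_ne hw (p-1) (by omega))).1 hB
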